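/- arXiv:2303.03763 — 8 statements merged into one kernel-verified Lean document; each statement's English description precedes it below -/
import Mathlib

section
/- Let M be a finitely generated free ℤ-module, ι a finite index set, and u : ι → Hom_ℤ(M, ℤ) a family of ℤ-linear functionals such that the map M → ℤ^ι, m ↦ (u(ρ)(m))_{ρ∈ι}, is injective. Fix an integer ℓ ≥ 1 and functions a, e : ι → ℤ. Then the map m'' ↦ m'' + ℓM is a bijection from the set { m'' ∈ M : 0 ≤ a(ρ) − ℓ·e(ρ) − u(ρ)(m'') ≤ ℓ − 1 for all ρ ∈ ι } onto the set of classes [m] ∈ M/ℓM such that for some (equivalently, every) representative m of the class there exists m' ∈ M with ⌊(a(ρ) − u(ρ)(m))/ℓ⌋ = e(ρ) + u(ρ)(m') for all ρ ∈ ι. -/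
/-- Two elements have the same class modulo `ℓM` iff they differ by a multiple of `ℓ`. -/
theorem mk_range_smul_id_eq_iff {M : Type*} [AddCommGroup M] [Module ℤ M] {ℓ : ℤ} {m n : M} :
    (Submodule.Quotient.mk m : M ⧸ LinearMap.range (ℓ • (LinearMap.id : M →ₗ[ℤ] M))) =
      Submodule.Quotient.mk n ↔ ∃ k : M, m = n + ℓ • k := by
  rw [Submodule.Quotient.eq, LinearMap.mem_range]
  refine exists_congr fun k => ?_
  have h : (ℓ • (LinearMap.id : M →ₗ[ℤ] M)) k = ℓ • k :=
    map_zsmul (LinearMap.evalAddMonoidHom k) ℓ LinearMap.id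
  rw [h, eq_sub_iff_add_eq', eq_comm]

theorem floor_intCast_div_eq_iff {ℓ : ℤ} (hℓ : 1 ≤ ℓ) (x k : ℤ) :
    ⌊(x : ℚ) / (ℓ : ℚ)⌋ = k ↔ 0 ≤ x - ℓ * k ∧ x - ℓ * k ≤ ℓ - 1 := by
  have hpos : (0 : ℚ) < ℓ := by exact_mod_cast hℓ
  rw [Int.floor_eq_iff, le_div_iff₀ hpos, div_lt_iff₀ hpos]
  norm_cast
  constructor <;> rintro ⟨h₁, h₂⟩ <;> constructor <;> linarith

/-- The floor condition at `m` with witness `m'` says that `m + ℓm'` has all coefficients in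
`{0, …, ℓ - 1}`. -/
theorem forall_floor_eq_add_iff {M : Type*} [AddCommGroup M] [Module ℤ M] {ι : Type*}
    (u : ι → (M →ₗ[ℤ] ℤ)) {ℓ : ℤ} (hℓ : 1 ≤ ℓ) (a e : ι → ℤ) (m m' : M) :
    (∀ ρ : ι, ⌊((a ρ - u ρ m : ℤ) : ℚ) / (ℓ : ℚ)⌋ = e ρ + u ρ m') ↔
      ∀ ρ : ι, 0 ≤ a ρ - ℓ * e ρ - u ρ (m + ℓ • m') ∧
        a ρ - ℓ * e ρ - u ρ (m + ℓ • m') ≤ ℓ - 1 := by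
  refine forall_congr' fun ρ => ?_
  have h : a ρ - ℓ * e ρ - u ρ (m + ℓ • m') = a ρ - u ρ m - ℓ * (e ρ + u ρ m') := by
    rw [map_add, map_zsmul, smul_eq_mul]
    ring
  rw [floor_intCast_div_eq_iff hℓ, h]

/-- Let `M` be a finitely generated free `ℤ`-module, `ι` a finite index
set, and `u : ι → Hom_ℤ(M, ℤ)` a family of functionals such that `m ↦ (u ρ m)_ρ` is
injective.  Fix an integer `ℓ ≥ 1` and `a e : ι → ℤ`.  Then `m'' ↦ m'' + ℓM` is a bijection
from `{m'' : 0 ≤ a ρ − ℓ·e ρ − u ρ m'' ≤ ℓ − 1 for all ρ}` onto the set of classes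
`[m] ∈ M/ℓM` such that for some (equivalently, every) representative `m` there exists
`m' ∈ M` with `⌊(a ρ − u ρ m)/ℓ⌋ = e ρ + u ρ m'` for all `ρ`. -/
theorem frobenius_multiplicity_bijection
    {M : Type*} [AddCommGroup M] [Module ℤ M] [Module.Free ℤ M] [Module.Finite ℤ M]
    {ι : Type*} [Finite ι]
    (u : ι → (M →ₗ[ℤ] ℤ))
    (hu : Function.Injective fun m : M => fun ρ : ι => u ρ m)
    (ℓ : ℤ) (hℓ : 1 ≤ ℓ) (a e : ι → ℤ) :
    Set.BijOn
      (fun m'' : M => (Submodule.Quotient.mk m'' :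
          M ⧸ LinearMap.range (ℓ • (LinearMap.id : M →ₗ[ℤ] M))))
      {m'' : M | ∀ ρ : ι,
        0 ≤ a ρ - ℓ * e ρ - u ρ m'' ∧ a ρ - ℓ * e ρ - u ρ m'' ≤ ℓ - 1}
      {c : M ⧸ LinearMap.range (ℓ • (LinearMap.id : M →ₗ[ℤ] M)) |
        ∃ m : M, Submodule.Quotient.mk m = c ∧
          ∃ m' : M, ∀ ρ : ι, ⌊((a ρ - u ρ m : ℤ) : ℚ) / (ℓ : ℚ)⌋ = e ρ + u ρ m'} ∧
    {c : M ⧸ LinearMap.range (ℓ • (LinearMap.id : M →ₗ[ℤ] M)) |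
        ∃ m : M, Submodule.Quotient.mk m = c ∧
          ∃ m' : M, ∀ ρ : ι, ⌊((a ρ - u ρ m : ℤ) : ℚ) / (ℓ : ℚ)⌋ = e ρ + u ρ m'}
      = {c : M ⧸ LinearMap.range (ℓ • (LinearMap.id : M →ₗ[ℤ] M)) |
          ∀ m : M, Submodule.Quotient.mk m = c →
            ∃ m' : M, ∀ ρ : ι, ⌊((a ρ - u ρ m : ℤ) : ℚ) / (ℓ : ℚ)⌋ = e ρ + u ρ m'} := by
  simp_rw [forall_floor_eq_add_iff u hℓ a e]
  refine ⟨⟨fun m hm => ⟨m, rfl, 0, by simpa using hm⟩, ?_, ?_⟩, ?_⟩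
  · intro m hm n hn hmn
    obtain ⟨k, rfl⟩ := mk_range_smul_id_eq_iff.mp hmn
    have hk : k = 0 := hu <| funext fun ρ => by
      have h₁ := hm ρ
      have h₂ := hn ρ
      rw [map_add, map_zsmul, smul_eq_mul] at h₁
      have hdvd : ℓ ∣ ℓ * u ρ k := dvd_mul_right _ _
      have hzero : ℓ * u ρ k = 0 :=
        Int.eq_zero_of_abs_lt_dvd hdvd (abs_lt.mpr ⟨by linarith, by linarith⟩)
      simpa [(by lia : ℓ ≠ 0)] using hzero
    rw [hk, zsmul_zero, add_zero]
  · rintro _ ⟨m, rfl, m', hm'⟩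
    exact ⟨m + ℓ • m', hm', mk_range_smul_id_eq_iff.mpr ⟨m', rfl⟩⟩
  · ext c
    constructor
    · rintro ⟨m, rfl, m', hm'⟩ n hn
      obtain ⟨k, rfl⟩ := mk_range_smul_id_eq_iff.mp hn
      refine ⟨m' - k, ?_⟩
      rwa [zsmul_sub, add_assoc, add_sub_cancel]
    · intro h
      obtain ⟨m, rfl⟩ := Submodule.Quotient.mk_surjective _ c
      exact ⟨m, rfl, h m rfl⟩
end

section
/- Let M be a finitely generated free ℤ-module, ι a finite index set, and u : ι → Hom_ℤ(M, ℤ) a family of ℤ-linear functionals. Call D, D' : ι → ℤ linearly equivalent (D ~ D') if there exists m ∈ M with D'(ρ) = D(ρ) + u(ρ)(m) for all ρ; for ℓ ≥ 1 let Frob_ℓ(D) be the set of linear-equivalence classes of the divisors ρ ↦ ⌊(D(ρ) − u(ρ)(m))/ℓ⌋ for m ∈ M, and Frob(D) = ⋃_{ℓ ≥ 1} Frob_ℓ(D). Fix a subset A ⊆ ι and let E : ι → ℤ be the divisor with E(ρ) = −1 for ρ ∈ A and E(ρ) = 0 for ρ ∉ A. Then [E] ∈ Frob(D) if and only if there exists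 r : ι → ℤ with r(ρ) ≥ 0 for all ρ such that D is linearly equivalent to the divisor sending ρ to −1 − r(ρ) for ρ ∈ A and to r(ρ) for ρ ∉ A. -/
/-- Two (torus-invariant) divisors `D D' : ι → ℤ` are linearly equivalent with respect to the
family of functionals `u` if they differ by `ρ ↦ u ρ m` for some `m ∈ M`. -/
def LinearlyEquivalent {ι M : Type*} [AddCommGroup M] [Module ℤ M]
    (u : ι → (M →ₗ[ℤ] ℤ)) (D D' : ι → ℤ) : Prop :=
  ∃ m : M, ∀ ρ : ι, D' ρ = D ρ + u ρ m

theorem floor_intCast_div_intCast_eq_iff {x ℓ z : ℤ} (hℓ : 0 < ℓ) :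
    ⌊(x : ℚ) / (ℓ : ℚ)⌋ = z ↔ z * ℓ ≤ x ∧ x < (z + 1) * ℓ := by
  have hℓ' : (0 : ℚ) < ℓ := by exact_mod_cast hℓ
  rw [Int.floor_eq_iff, le_div_iff₀ hℓ', div_lt_iff₀ hℓ']
  norm_cast

/-- Fix `A ⊆ ι` and let `E` be the divisor with `E ρ = −1` for `ρ ∈ A` and
`E ρ = 0` otherwise.  Then `[E] ∈ Frob(D) = ⋃_{ℓ ≥ 1} Frob_ℓ(D)` (i.e. `E` is linearly
equivalent to a floor divisor `ρ ↦ ⌊(D ρ − u ρ m)/ℓ⌋` for some `ℓ ≥ 1` and `m ∈ M`) if and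
only if there exists `r : ι → ℤ` with `r ρ ≥ 0` for all `ρ` such that `D` is linearly
equivalent to the divisor sending `ρ` to `−1 − r ρ` for `ρ ∈ A` and to `r ρ` for `ρ ∉ A`. -/
theorem vertex_mem_frob_iff
    {M : Type*} [AddCommGroup M] [Module ℤ M] [Module.Free ℤ M] [Module.Finite ℤ M]
    {ι : Type*} [Finite ι] [DecidableEq ι]
    (u : ι → (M →ₗ[ℤ] ℤ)) (A : Finset ι) (D : ι → ℤ) :
    (∃ ℓ : ℤ, 1 ≤ ℓ ∧ ∃ m : M,
        LinearlyEquivalent u (fun ρ => ⌊((D ρ - u ρ m : ℤ) : ℚ) / (ℓ : ℚ)⌋)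
          (fun ρ => if ρ ∈ A then (-1 : ℤ) else 0)) ↔
    (∃ r : ι → ℤ, (∀ ρ, 0 ≤ r ρ) ∧
        LinearlyEquivalent u D (fun ρ => if ρ ∈ A then -1 - r ρ else r ρ)) := by
  constructor
  · rintro ⟨ℓ, hℓ, m, m', h⟩
    have hfloor (ρ : ι) := (floor_intCast_div_intCast_eq_iff (by lia)).1
      (eq_sub_of_add_eq (h ρ).symm)
    have hu (ρ : ι) : u ρ (ℓ • m' - m) = ℓ * u ρ m' - u ρ m := by
      rw [map_sub, map_zsmul, smul_eq_mul]
    refine ⟨fun ρ => if ρ ∈ A then -1 - (D ρ + u ρ (ℓ • m' - m)) else D ρ + u ρ (ℓ • m' - m),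
      fun ρ => ?_, ℓ • m' - m, fun ρ => ?_⟩
    · have := hfloor ρ
      simp only [hu] at this ⊢
      split_ifs at this ⊢ <;> nlinarith
    · dsimp only
      split_ifs <;> ring
  · rintro ⟨r, hr, m, h⟩
    obtain ⟨B, hB⟩ := (Set.finite_range r).bddAbove
    have hrB (ρ : ι) : r ρ ≤ B := hB ⟨ρ, rfl⟩
    refine ⟨max B 0 + 1, by lia, -m, 0, fun ρ => ?_⟩
    rw [map_zero, add_zero, eq_comm, floor_intCast_div_intCast_eq_iff (by lia), map_neg]
    have hρ := h ρ
    have := hr ρ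
    have := hrB ρ
    dsimp only at hρ ⊢
    split_ifs at hρ ⊢ <;> lia
end

section
/- Let M be a finitely generated free ℤ-module, ι a finite index set, and u : ι → Hom_ℤ(M, ℤ) a family of ℤ-linear functionals, extended ℝ-linearly to M ⊗ ℝ. Call D, D' : ι → ℤ linearly equivalent if there exists m ∈ M with D'(ρ) = D(ρ) + u(ρ)(m) for all ρ. Then the following two sets of linear-equivalence classes of integer divisors coincide: (a) the classes of the divisors ρ ↦ −⌈u(ρ)(x)⌉ for x ∈ M ⊗ ℝ; and (b) the classes of the divisors ρ ↦ ⌊(−u(ρ)(m))/ℓ⌋ for m ∈ M and integers ℓ ≥ 1. -/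
/-- For finitely many positive reals there is a `ℚ`-linear functional on `ℝ` with rational values
that is positive on all of them. -/
theorem exists_rat_linearMap_pos {S : Set ℝ} (hS : S.Finite) (hpos : ∀ s ∈ S, 0 < s) :
    ∃ f : ℝ →ₗ[ℚ] ℚ, ∀ s ∈ S, 0 < f s := by
  let B := Module.Basis.ofVectorSpace ℚ ℝ
  let g : ℝ → (Module.Basis.ofVectorSpaceIndex ℚ ℝ → ℝ) → ℝ :=
    fun s q => ∑ b ∈ (B.repr s).support, (B.repr s b : ℝ) * q b
  have hg (s : ℝ) : Continuous (g s) := by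
    dsimp only [g]
    fun_prop
  have hopen : IsOpen (⋂ s ∈ S, {q | 0 < g s q}) :=
    hS.isOpen_biInter fun s _ => isOpen_lt continuous_const (hg s)
  have hgB (s : ℝ) : g s (fun b => B b) = s := by
    conv_rhs => rw [← B.linearCombination_repr s]
    simp [g, Finsupp.linearCombination_apply, Finsupp.sum, Rat.smul_def]
  have hdense : DenseRange
      (Pi.map fun (_ : Module.Basis.ofVectorSpaceIndex ℚ ℝ) (q : ℚ) => (q : ℝ)) :=
    DenseRange.piMap fun _ => Rat.denseRange_cast
  obtain ⟨q, hq⟩ := hdense.exists_mem_open hopen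
    ⟨fun b => B b, by simpa [hgB] using hpos⟩
  refine ⟨B.constr ℚ q, fun s hs => ?_⟩
  have h : 0 < g s (Pi.map (fun _ (q : ℚ) => (q : ℝ)) q) := by
    simpa using Set.mem_iInter₂.1 hq s hs
  have hcast : ((B.constr ℚ q s : ℚ) : ℝ) = g s (Pi.map (fun _ (q : ℚ) => (q : ℝ)) q) := by
    simp [g, Module.Basis.constr_apply, Finsupp.sum]
  exact_mod_cast hcast ▸ h

/-- The real-linear extension of an integral functional, in coordinates. -/
theorem linearMap_real_apply_eq_sum {n : ℕ} (u : (Fin n → ℤ) →ₗ[ℤ] ℤ) (v : (Fin n → ℝ) →ₗ[ℝ] ℝ)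
    (h : ∀ m : Fin n → ℤ, v (fun i => (m i : ℝ)) = (u m : ℝ)) (x : Fin n → ℝ) :
    v x = ∑ i, (u (Pi.single i 1) : ℝ) * x i := by
  rw [LinearMap.pi_apply_eq_sum_univ v x]
  refine Finset.sum_congr rfl fun i _ => ?_
  rw [← h, smul_eq_mul, mul_comm]
  congr 2
  ext j
  simp [Pi.single_apply, eq_comm]

/-- The rounded-up values of finitely many integral functionals at a real point are attained at a
rational point `m / ℓ`. -/
theorem exists_int_ceil_bounds {n : ℕ} {ι : Type*} [Finite ι]
    (u : ι → ((Fin n → ℤ) →ₗ[ℤ] ℤ)) (v : ι → ((Fin n → ℝ) →ₗ[ℝ] ℝ))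
    (hv : ∀ (ρ : ι) (m : Fin n → ℤ), v ρ (fun i => (m i : ℝ)) = (u ρ m : ℝ)) (x : Fin n → ℝ) :
    ∃ ℓ : ℤ, 1 ≤ ℓ ∧ ∃ m : Fin n → ℤ, ∀ ρ,
      (⌈v ρ x⌉ - 1) * ℓ < u ρ m ∧ u ρ m ≤ ⌈v ρ x⌉ * ℓ := by
  let S : Set ℝ := {s | 0 < s} ∩ ({1} ∪ Set.range (fun ρ => (⌈v ρ x⌉ : ℝ) - v ρ x) ∪
    Set.range fun ρ => v ρ x - ((⌈v ρ x⌉ - 1 : ℤ) : ℝ))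
  have hS : S.Finite := Set.Finite.inter_of_right
    (((Set.finite_singleton _).union (Set.finite_range _)).union (Set.finite_range _)) _
  obtain ⟨f, hf⟩ := exists_rat_linearMap_pos hS fun s hs => hs.1
  have hf1 : 0 < f 1 := hf 1 ⟨zero_lt_one (α := ℝ), by simp⟩
  have hfint (c : ℤ) : f (c : ℝ) = c * f 1 := by
    simpa using map_zsmul f c (1 : ℝ)
  have hup (ρ : ι) : f (v ρ x) ≤ ⌈v ρ x⌉ * f 1 := by
    rw [← hfint, ← sub_nonneg, ← map_sub]
    rcases (sub_nonneg.2 (Int.le_ceil (v ρ x))).eq_or_lt with h | h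
    · simp [← h]
    · exact (hf _ ⟨h, by simp⟩).le
  have hlow (ρ : ι) : ((⌈v ρ x⌉ - 1 : ℤ) : ℚ) * f 1 < f (v ρ x) := by
    rw [← hfint, ← sub_pos, ← map_sub]
    refine hf _ ⟨?_, Or.inr ⟨ρ, rfl⟩⟩
    have := Int.ceil_lt_add_one (v ρ x)
    simp only [Set.mem_ofPred_eq]
    push_cast
    linarith
  obtain ⟨⟨N, hN⟩, hNint⟩ := IsLocalization.exist_integer_multiples_of_finite
    (nonZeroDivisors ℤ) (fun o : Option (Fin n) => f (o.elim 1 x))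
  have hN0 : N ≠ 0 := nonZeroDivisors.ne_zero hN
  choose k hk using hNint
  have hk' (o) : (k o : ℚ) = N * f (o.elim 1 x) := by simpa using hk o
  have hu (ρ : ι) : ((u ρ fun i => N * k (some i) : ℤ) : ℚ) = N ^ 2 * f (v ρ x) := by
    rw [linearMap_real_apply_eq_sum (u ρ) (v ρ) (hv ρ), LinearMap.pi_apply_eq_sum_univ, map_sum,
      Int.cast_sum, Finset.mul_sum]
    refine Finset.sum_congr rfl fun i _ => ?_
    have h1 : f ((u ρ (Pi.single i 1) : ℝ) * x i) = u ρ (Pi.single i 1) * f (x i) := by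
      simpa using map_zsmul f (u ρ (Pi.single i 1)) (x i)
    have h2 : (fun j => if i = j then (1 : ℤ) else 0) = Pi.single i 1 := by
      ext j
      simp [Pi.single_apply, eq_comm]
    have h3 : (k (some i) : ℚ) = N * f (x i) := hk' (some i)
    rw [h1, h2]
    push_cast [smul_eq_mul]
    rw [h3]
    ring
  have hl : ((N * k none : ℤ) : ℚ) = N ^ 2 * f 1 := by
    have h3 : (k none : ℚ) = N * f 1 := hk' none
    push_cast
    rw [h3]
    ring
  have hNsq : (0 : ℚ) < (N : ℚ) ^ 2 := by positivity
  refine ⟨N * k none, ?_, fun i => N * k (some i), fun ρ => ⟨?_, ?_⟩⟩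
  · have : (0 : ℚ) < ((N * k none : ℤ) : ℚ) := hl ▸ mul_pos hNsq hf1
    exact_mod_cast this
  · rw [← Int.cast_lt (R := ℚ), hu, Int.cast_mul, hl, mul_left_comm]
    exact mul_lt_mul_of_pos_left (hlow ρ) hNsq
  · rw [← Int.cast_le (R := ℚ), hu, Int.cast_mul, hl, mul_left_comm]
    exact mul_le_mul_of_nonneg_left (hup ρ) hNsq.le

/-- Let `M = ℤⁿ`, `ι` a finite index set, `u : ι → Hom_ℤ(M, ℤ)` a family of
functionals, `ℝ`-linearly extended to `v` on `M ⊗ ℝ = ℝⁿ`.  The following two sets of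
linear-equivalence classes of integer divisors coincide:
(a) the classes of the divisors `ρ ↦ −⌈u ρ x⌉` for `x ∈ M ⊗ ℝ` (the Thomsen collection), and
(b) the classes of the divisors `ρ ↦ ⌊(−u ρ m)/ℓ⌋` for `m ∈ M` and integers `ℓ ≥ 1`
(`Frob(0)`). -/
theorem thomsen_collection_eq_frob_zero
    {n : ℕ} {ι : Type*} [Finite ι]
    (u : ι → ((Fin n → ℤ) →ₗ[ℤ] ℤ))
    (v : ι → ((Fin n → ℝ) →ₗ[ℝ] ℝ))
    (hv : ∀ (ρ : ι) (m : Fin n → ℤ), v ρ (fun i => (m i : ℝ)) = (u ρ m : ℝ))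
    (E : ι → ℤ) :
    (∃ x : Fin n → ℝ, LinearlyEquivalent u (fun ρ => -⌈v ρ x⌉) E) ↔
    (∃ ℓ : ℤ, 1 ≤ ℓ ∧ ∃ m : Fin n → ℤ,
      LinearlyEquivalent u (fun ρ => ⌊((-(u ρ m) : ℤ) : ℚ) / (ℓ : ℚ)⌋) E) := by
  constructor
  · rintro ⟨x, hx⟩
    obtain ⟨ℓ, hℓ, m, hm⟩ := exists_int_ceil_bounds u v hv x
    refine ⟨ℓ, hℓ, m, ?_⟩
    convert hx using 2 with ρ
    have hℓ0 : (0 : ℚ) < ℓ := by exact_mod_cast hℓ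
    obtain ⟨h1, h2⟩ := hm ρ
    rw [Int.floor_eq_iff, le_div_iff₀ hℓ0, div_lt_iff₀ hℓ0]
    constructor
    · have : -⌈v ρ x⌉ * ℓ ≤ -(u ρ m) := by linarith
      exact_mod_cast this
    · have : -(u ρ m) < (-⌈v ρ x⌉ + 1) * ℓ := by linarith
      exact_mod_cast this
  · rintro ⟨ℓ, hℓ, m, hm⟩
    refine ⟨(ℓ : ℝ)⁻¹ • fun i => (m i : ℝ), ?_⟩
    convert hm using 2 with ρ
    rw [map_smul, hv, ← Int.floor_neg, ← Rat.floor_cast (α := ℝ)]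
    congr 1
    push_cast [smul_eq_mul]
    ring
end

section
/- Let M be a finitely generated free ℤ-module, ι a finite index set, and u : ι → Hom_ℤ(M, ℤ) a family of ℤ-linear functionals, extended ℝ-linearly to M ⊗ ℝ. Let W := {(u(ρ)(w))_{ρ∈ι} : w ∈ M ⊗ ℝ} ⊆ ℝ^ι, let Pic_ℝ := ℝ^ι / W with quotient map [·] (applied to integer divisors via ℤ^ι ⊆ ℝ^ι), and let Z ⊆ Pic_ℝ be the image of the cube [−1, 0]^ι. Let D : ι → ℤ, and suppose p ∈ Z is the class in Pic_ℝ of the divisor ρ ↦ ⌊(D(ρ) − u(ρ)(m))/ℓ⌋ for some integer ℓ ≥ 1 and some m ∈ M. Then there exist z ∈ Z and a real number t ≥ 0 such that [D] = p + t·(p − z); in particular [D] lies in the translated cone C_p = p + cone(p − Z), the convex cone generated by {p − z : z ∈ Z} translated to p. -/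
/-- The real Picard group `Pic_ℝ = ℝ^ι / W`, where
`W = {(u ρ w)_ρ : w ∈ M ⊗ ℝ}` is the image of `M ⊗ ℝ = ℝⁿ` under the real extensions `v` of
the functionals `u`. -/
abbrev PicR {n : ℕ} {ι : Type*} (v : ι → ((Fin n → ℝ) →ₗ[ℝ] ℝ)) : Type _ :=
  (ι → ℝ) ⧸ LinearMap.range (LinearMap.pi v)

/-- The quotient map `ℝ^ι → Pic_ℝ`. -/
noncomputable def picMk {n : ℕ} {ι : Type*} (v : ι → ((Fin n → ℝ) →ₗ[ℝ] ℝ)) (x : ι → ℝ) :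
    PicR v :=
  Submodule.Quotient.mk x

/-- The zonotope `Z ⊆ Pic_ℝ`: the image of the cube `[−1, 0]^ι`. -/
noncomputable def zonotope {n : ℕ} {ι : Type*} (v : ι → ((Fin n → ℝ) →ₗ[ℝ] ℝ)) :
    Set (PicR v) :=
  picMk v '' {x : ι → ℝ | ∀ ρ, -1 ≤ x ρ ∧ x ρ ≤ 0}

theorem picMk_eq_iff {n : ℕ} {ι : Type*} {v : ι → ((Fin n → ℝ) →ₗ[ℝ] ℝ)} {x y : ι → ℝ} :
    picMk v x = picMk v y ↔ ∃ w, ∀ ρ, v ρ w = x ρ - y ρ := by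
  simp [picMk, Submodule.Quotient.eq, LinearMap.mem_range, funext_iff]

/-- Let `D : ι → ℤ` and suppose `p ∈ Z` is the class in `Pic_ℝ` of the floor
divisor `ρ ↦ ⌊(D ρ − u ρ m)/ℓ⌋` for some integer `ℓ ≥ 1` and some `m ∈ M`.  Then there exist
`z ∈ Z` and a real number `t ≥ 0` such that `[D] = p + t • (p − z)`; in particular `[D]` lies
in the translated cone `C_p = p + cone(p − Z)`. -/
theorem classOf_D_mem_translated_cone
    {n : ℕ} {ι : Type*} [Finite ι]
    (u : ι → ((Fin n → ℤ) →ₗ[ℤ] ℤ))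
    (v : ι → ((Fin n → ℝ) →ₗ[ℝ] ℝ))
    (hv : ∀ (ρ : ι) (m : Fin n → ℤ), v ρ (fun i => (m i : ℝ)) = (u ρ m : ℝ))
    (D : ι → ℤ) (p : PicR v) (hpZ : p ∈ zonotope v)
    (ℓ : ℤ) (hℓ : 1 ≤ ℓ) (m : Fin n → ℤ)
    (hp : p = picMk v fun ρ => (⌊((D ρ - u ρ m : ℤ) : ℝ) / (ℓ : ℝ)⌋ : ℝ)) :
    ∃ z ∈ zonotope v, ∃ t : ℝ, 0 ≤ t ∧
      picMk v (fun ρ => (D ρ : ℝ)) = p + t • (p - z) := by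
  have hℓ' : (0 : ℝ) ≤ ℓ - 1 := by exact_mod_cast sub_nonneg.mpr hℓ
  let k : ι → ℤ := fun ρ => (D ρ - u ρ m) % ℓ
  have hk0 (ρ : ι) : (0 : ℝ) ≤ k ρ := by exact_mod_cast Int.emod_nonneg _ (by lia)
  have hk1 (ρ : ι) : (k ρ : ℝ) ≤ ℓ - 1 := by
    exact_mod_cast Int.le_sub_one_of_lt (Int.emod_lt_of_pos (D ρ - u ρ m) (by lia : 0 < ℓ))
  refine ⟨picMk v fun ρ => -((k ρ : ℝ) / (ℓ - 1)), ⟨_, fun ρ => ⟨?_, ?_⟩, rfl⟩, ℓ - 1, hℓ', ?_⟩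
  · exact neg_le_neg (div_le_one_of_le₀ (hk1 ρ) hℓ')
  · exact neg_nonpos.mpr (div_nonneg (hk0 ρ) hℓ')
  · rw [hp]
    refine picMk_eq_iff.mpr ⟨fun i => (m i : ℝ), fun ρ => ?_⟩
    have hdiv : (ℓ : ℝ) * ((D ρ - u ρ m) / ℓ : ℤ) + k ρ = D ρ - u ρ m := by
      exact_mod_cast Int.mul_ediv_add_emod (D ρ - u ρ m) ℓ
    have hcancel : ((ℓ : ℝ) - 1) * (k ρ / (ℓ - 1)) = k ρ :=
      mul_div_cancel_of_imp' fun h => le_antisymm (h ▸ hk1 ρ) (hk0 ρ)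
    simp only [hv, Int.floor_div_cast_of_nonneg (by lia : 0 ≤ ℓ), Int.floor_intCast,
      Pi.add_apply, Pi.smul_apply, Pi.sub_apply, smul_eq_mul]
    linear_combination hdiv + hcancel
end

section
/- Let M be a finitely generated free ℤ-module, ι a finite index set, and u : ι → Hom_ℤ(M, ℤ) a family of ℤ-linear functionals, extended ℚ-linearly to M ⊗ ℚ. Call D, D' : ι → ℤ linearly equivalent if there exists m ∈ M with D'(ρ) = D(ρ) + u(ρ)(m) for all ρ. Fix A ⊆ ι and let D be the divisor with D(ρ) = −1 for ρ ∈ A and D(ρ) = 0 otherwise. Then for every integer ℓ ≥ 1, the set Frob_ℓ(D) of linear-equivalence classes of the divisors ρ ↦ ⌊(D(ρ) − u(ρ)(m))/ℓ⌋, m ∈ M, equals the set of classes of the divisors sending ρ to ⌈u(ρ)(q)⌉ − 1 for ρ ∈ A and to ⌊u(ρ)(q)⌋ for ρ ∉ A, as q ranges over (1/ℓ)·M ⊆ M ⊗ ℚ. Consequently, Frob(D) = ⋃_{ℓ≥1} Frob_ℓ(D) equals the set of classes of the divisors ρ ↦ (⌈u(ρ)(q)⌉ − 1 if ρ ∈ A,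 ⌊u(ρ)(q)⌋ if ρ ∉ A) as q ranges over all of M ⊗ ℚ. -/
theorem floor_intCast_sub_one_div_eq_ceil_sub_one {K : Type*} [Field K] [LinearOrder K]
    [IsStrictOrderedRing K] [FloorRing K] (k : ℤ) {l : ℤ} (hl : 0 < l) :
    ⌊((k - 1 : ℤ) : K) / (l : K)⌋ = ⌈(k : K) / (l : K)⌉ - 1 := by
  have hl' : (0 : K) < l := by exact_mod_cast hl
  refine eq_of_forall_le_iff fun z => ?_
  rw [Int.le_floor, le_div_iff₀ hl', Int.le_sub_one_iff, Int.lt_ceil, lt_div_iff₀ hl']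
  norm_cast
  exact Int.le_sub_one_iff

theorem exists_eq_inv_smul_intCast {ι : Type*} [Finite ι] (q : ι → ℚ) :
    ∃ l : ℤ, 1 ≤ l ∧ ∃ m : ι → ℤ, q = (l : ℚ)⁻¹ • fun i => (m i : ℚ) := by
  have := Fintype.ofFinite ι
  have hpos : 0 < ∏ i, (q i).den := Finset.prod_pos fun i _ => (q i).pos
  have hdvd (i : ι) : (q i).den ∣ ∏ j, (q j).den := Finset.dvd_prod_of_mem _ (Finset.mem_univ i)
  choose c hc using hdvd
  refine ⟨(∏ i, (q i).den : ℕ), by exact_mod_cast hpos, fun i => (q i).num * c i, ?_⟩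
  funext i
  have hne : ((∏ j, (q j).den : ℕ) : ℚ) ≠ 0 := by exact_mod_cast hpos.ne'
  rw [Pi.smul_apply, smul_eq_mul, Int.cast_natCast, eq_inv_mul_iff_mul_eq₀ hne, hc i]
  push_cast
  rw [mul_right_comm, mul_comm ((q i).den : ℚ), Rat.mul_den_eq_num]

/-- Let `M = ℤⁿ`, `ι` finite, `u : ι → Hom_ℤ(M, ℤ)` extended `ℚ`-linearly
to `vq` on `M ⊗ ℚ = ℚⁿ`.  Fix `A ⊆ ι` and let `D` be the divisor with `D ρ = −1` for `ρ ∈ A`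
and `0` otherwise.  Then for every integer `ℓ ≥ 1`, the set `Frob_ℓ(D)` of classes of the
floor divisors `ρ ↦ ⌊(D ρ − u ρ m)/ℓ⌋`, `m ∈ M`, equals the set of classes of the divisors
sending `ρ` to `⌈u ρ q⌉ − 1` for `ρ ∈ A` and to `⌊u ρ q⌋` for `ρ ∉ A`, as `q` ranges over
`(1/ℓ)·M ⊆ M ⊗ ℚ`.  Consequently `Frob(D) = ⋃_{ℓ≥1} Frob_ℓ(D)` equals the set of classes of
the divisors `ρ ↦ (⌈u ρ q⌉ − 1 if ρ ∈ A, ⌊u ρ q⌋ if ρ ∉ A)` as `q` ranges over all of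
`M ⊗ ℚ`. -/
theorem frob_of_cube_vertex_eq_ceil_floor_classes
    {n : ℕ} {ι : Type*} [Finite ι] [DecidableEq ι]
    (u : ι → ((Fin n → ℤ) →ₗ[ℤ] ℤ))
    (vq : ι → ((Fin n → ℚ) →ₗ[ℚ] ℚ))
    (hvq : ∀ (ρ : ι) (m : Fin n → ℤ), vq ρ (fun i => (m i : ℚ)) = (u ρ m : ℚ))
    (A : Finset ι) :
    (∀ ℓ : ℤ, 1 ≤ ℓ → ∀ E : ι → ℤ,
      ((∃ m : Fin n → ℤ,
          LinearlyEquivalent u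
            (fun ρ => ⌊(((if ρ ∈ A then (-1 : ℤ) else 0) - u ρ m : ℤ) : ℚ) / (ℓ : ℚ)⌋) E) ↔
        (∃ q : Fin n → ℚ, (∃ m : Fin n → ℤ, q = (ℓ : ℚ)⁻¹ • fun i => (m i : ℚ)) ∧
          LinearlyEquivalent u
            (fun ρ => if ρ ∈ A then ⌈vq ρ q⌉ - 1 else ⌊vq ρ q⌋) E))) ∧
    (∀ E : ι → ℤ,
      ((∃ ℓ : ℤ, 1 ≤ ℓ ∧ ∃ m : Fin n → ℤ,
          LinearlyEquivalent u
            (fun ρ => ⌊(((if ρ ∈ A then (-1 : ℤ) else 0) - u ρ m : ℤ) : ℚ) / (ℓ : ℚ)⌋) E) ↔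
        (∃ q : Fin n → ℚ,
          LinearlyEquivalent u
            (fun ρ => if ρ ∈ A then ⌈vq ρ q⌉ - 1 else ⌊vq ρ q⌋) E))) := by
  have key (l : ℤ) (hl : 1 ≤ l) (m : Fin n → ℤ) :
      (fun ρ => ⌊(((if ρ ∈ A then (-1 : ℤ) else 0) - u ρ (-m) : ℤ) : ℚ) / (l : ℚ)⌋) =
        fun ρ => if ρ ∈ A then ⌈vq ρ ((l : ℚ)⁻¹ • fun i => (m i : ℚ))⌉ - 1
          else ⌊vq ρ ((l : ℚ)⁻¹ • fun i => (m i : ℚ))⌋ := by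
    funext ρ
    rw [map_smul, hvq, smul_eq_mul, inv_mul_eq_div, map_neg]
    split_ifs
    · rw [← floor_intCast_sub_one_div_eq_ceil_sub_one (u ρ m) (by lia : 0 < l),
        show -1 - -u ρ m = u ρ m - 1 by ring]
    · rw [zero_sub, neg_neg]
  have main (l : ℤ) (hl : 1 ≤ l) (E : ι → ℤ) :
      (∃ m : Fin n → ℤ, LinearlyEquivalent u
        (fun ρ => ⌊(((if ρ ∈ A then (-1 : ℤ) else 0) - u ρ m : ℤ) : ℚ) / (l : ℚ)⌋) E) ↔
      ∃ q : Fin n → ℚ, (∃ m : Fin n → ℤ, q = (l : ℚ)⁻¹ • fun i => (m i : ℚ)) ∧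
        LinearlyEquivalent u (fun ρ => if ρ ∈ A then ⌈vq ρ q⌉ - 1 else ⌊vq ρ q⌋) E := by
    constructor
    · rintro ⟨m, h⟩
      refine ⟨_, ⟨-m, rfl⟩, ?_⟩
      rwa [← key l hl, neg_neg]
    · rintro ⟨_, ⟨m, rfl⟩, h⟩
      exact ⟨-m, by rwa [key l hl]⟩
  refine ⟨main, fun E => ⟨?_, ?_⟩⟩
  · rintro ⟨l, hl, h⟩
    obtain ⟨q, -, hq⟩ := (main l hl E).1 h
    exact ⟨q, hq⟩
  · rintro ⟨q, hq⟩
    obtain ⟨l, hl, hm⟩ := exists_eq_inv_smul_intCast q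
    exact ⟨l, hl, (main l hl E).2 ⟨q, hm, hq⟩⟩
end

section
/- Let M be a finitely generated free ℤ-module, ι a finite index set, and u : ι → Hom_ℤ(M, ℤ) a family of ℤ-linear functionals. Call D, D' : ι → ℤ linearly equivalent if there exists m ∈ M with D'(ρ) = D(ρ) + u(ρ)(m) for all ρ, and for ℓ ≥ 1 let Frob_ℓ(D) be the set of linear-equivalence classes of the divisors ρ ↦ ⌊(D(ρ) − u(ρ)(m))/ℓ⌋ for m ∈ M. Then for every D : ι → ℤ, the set Frob(D) := ⋃_{ℓ ≥ 1} Frob_ℓ(D), viewed as a subset of the quotient group ℤ^ι / {(u(ρ)(m))_{ρ∈ι} : m ∈ M}, is finite. -/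
/-- Every element of a finite free `ℤ`-module is congruent modulo `l` to one whose values under
a linear functional `f` are bounded by `l` times a constant depending only on `f`. -/
theorem exists_bounded_residue {M ι : Type*} [AddCommGroup M] [Fintype ι]
    (b : Module.Basis ι ℤ M) {l : ℤ} (hl : 1 ≤ l) (m : M) :
    ∃ q r : M, m = l • q + r ∧ ∀ f : M →ₗ[ℤ] ℤ, |f r| ≤ l * ∑ i, |f (b i)| := by
  refine ⟨∑ i, (b.repr m i / l) • b i, ∑ i, (b.repr m i % l) • b i, ?_, fun f => ?_⟩
  · conv_lhs => rw [← b.sum_repr m]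
    rw [Finset.smul_sum, ← Finset.sum_add_distrib]
    refine Finset.sum_congr rfl fun i _ => ?_
    rw [smul_smul, ← add_smul, Int.mul_ediv_add_emod]
  · rw [map_sum, Finset.mul_sum]
    refine (Finset.abs_sum_le_sum_abs _ _).trans (Finset.sum_le_sum fun i _ => ?_)
    rw [map_smul, smul_eq_mul, abs_mul, abs_of_nonneg (Int.emod_nonneg _ (by lia))]
    exact mul_le_mul_of_nonneg_right (Int.emod_lt_of_pos _ (by lia)).le (abs_nonneg _)

/-- Let `M` be a finitely generated free `ℤ`-module, `ι` a finite index
set, and `u : ι → Hom_ℤ(M, ℤ)`.  Then for every `D : ι → ℤ`, the set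
`Frob(D) = ⋃_{ℓ ≥ 1} Frob_ℓ(D)` of linear-equivalence classes of the floor divisors
`ρ ↦ ⌊(D ρ − u ρ m)/ℓ⌋` (`ℓ ≥ 1`, `m ∈ M`), viewed as a subset of the quotient group
`ℤ^ι / {(u ρ m)_ρ : m ∈ M}`, is finite. -/
theorem frob_finite
    {M : Type*} [AddCommGroup M] [Module ℤ M] [Module.Free ℤ M] [Module.Finite ℤ M]
    {ι : Type*} [Finite ι]
    (u : ι → (M →ₗ[ℤ] ℤ)) (D : ι → ℤ) :
    {c : (ι → ℤ) ⧸ LinearMap.range (LinearMap.pi u) |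
      ∃ ℓ : ℤ, 1 ≤ ℓ ∧ ∃ m : M,
        c = Submodule.Quotient.mk (fun ρ => ⌊((D ρ - u ρ m : ℤ) : ℚ) / (ℓ : ℚ)⌋)}.Finite := by
  classical
  cases nonempty_fintype ι
  obtain rfl := Subsingleton.elim ‹Module ℤ M› (AddCommGroup.toIntModule M)
  let b := Module.Free.chooseBasis ℤ M
  let B : ι → ℤ := fun ρ => |D ρ| + ∑ i, |u ρ (b i)|
  refine ((Set.finite_Icc (-B) B).image
    (Submodule.Quotient.mk (p := LinearMap.range (LinearMap.pi u)))).subset ?_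
  rintro _ ⟨l, hl, m, rfl⟩
  obtain ⟨q, r, rfl, hr⟩ := exists_bounded_residue b hl m
  have hl0 : (0 : ℚ) < l := by exact_mod_cast hl
  have key : ∀ ρ, |D ρ - u ρ r| ≤ l * B ρ := fun ρ => by
    have h := abs_sub (D ρ) (u ρ r)
    have := hr (u ρ)
    have := le_mul_of_one_le_left (abs_nonneg (D ρ)) hl
    simp only [B, mul_add]
    linarith
  refine ⟨fun ρ => ⌊((D ρ - u ρ r : ℤ) : ℚ) / (l : ℚ)⌋, ⟨fun ρ => ?_, fun ρ => ?_⟩, ?_⟩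
  · rw [Int.le_floor, le_div_iff₀ hl0]
    have := (abs_le.mp (key ρ)).1
    rw [Pi.neg_apply]
    norm_cast
    linarith
  · rw [← Int.cast_le (R := ℚ)]
    refine (Int.floor_le _).trans ?_
    rw [div_le_iff₀ hl0]
    have := (abs_le.mp (key ρ)).2
    norm_cast
    linarith
  · rw [Submodule.Quotient.eq]
    refine ⟨q, funext fun ρ => ?_⟩
    have h : ((D ρ - u ρ (l • q + r) : ℤ) : ℚ) / (l : ℚ)
        = ((D ρ - u ρ r : ℤ) : ℚ) / (l : ℚ) - (u ρ q : ℤ) := by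
      rw [map_add, map_smul, smul_eq_mul]
      push_cast
      field_simp
      ring
    simp only [LinearMap.pi_apply, Pi.sub_apply, h, Int.floor_sub_intCast]
    ring
end

section
/- Let M be a finitely generated free ℤ-module, ι a finite index set, and u : ι → Hom_ℤ(M, ℤ) a family of ℤ-linear functionals, extended ℝ-linearly to M ⊗ ℝ. Let W := {(u(ρ)(w))_{ρ∈ι} : w ∈ M ⊗ ℝ} ⊆ ℝ^ι, let Pic_ℝ := ℝ^ι / W with quotient map [·], and let Z ⊆ Pic_ℝ be the image of the cube [−1, 0]^ι. Then for every D : ι → ℤ there exists an integer L such that for all ℓ ≥ L and all m ∈ M, the class in Pic_ℝ of the divisor ρ ↦ ⌊(D(ρ) − u(ρ)(m))/ℓ⌋ lies in Z. -/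
open Filter Topology in
/-- A compact family of affine systems of inequalities `t * E - 1 ≤ F + v w ≤ t * E` that is
solvable for arbitrarily small `t = 1 / ℓ` is solvable for `t = 0`. -/
theorem exists_mem_cube_of_frequently {n : ℕ} {ι : Type*}
    (v : ι → ((Fin n → ℝ) →ₗ[ℝ] ℝ)) {K : Set (Fin n → ℝ)} (hK : IsCompact K) (E F : ι → ℝ)
    (h : ∃ᶠ ℓ : ℤ in atTop, ∃ w ∈ K, ∀ ρ,
      (ℓ : ℝ)⁻¹ * E ρ - 1 ≤ F ρ + v ρ w ∧ F ρ + v ρ w ≤ (ℓ : ℝ)⁻¹ * E ρ) :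
    ∃ w ∈ K, ∀ ρ, -1 ≤ F ρ + v ρ w ∧ F ρ + v ρ w ≤ 0 := by
  have : CompactSpace K := isCompact_iff_compactSpace.mp hK
  have hvc : ∀ ρ, Continuous (v ρ) := fun ρ => (v ρ).continuous_of_finiteDimensional
  let S : Set (ℝ × K) := {p | ∀ ρ,
    p.1 * E ρ - 1 ≤ F ρ + v ρ p.2 ∧ F ρ + v ρ p.2 ≤ p.1 * E ρ}
  have hS : IsClosed S := by
    simp only [S, Set.ofPred_forall, Set.ofPred_and]
    refine isClosed_iInter fun ρ => ?_
    have hcont : Continuous fun p : ℝ × K => F ρ + v ρ p.2 :=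
      continuous_const.add ((hvc ρ).comp (continuous_subtype_val.comp continuous_snd))
    exact (isClosed_le (by fun_prop) hcont).inter (isClosed_le hcont (by fun_prop))
  have hlim : Tendsto (fun ℓ : ℤ => (ℓ : ℝ)⁻¹) atTop (𝓝 0) :=
    tendsto_inv_atTop_zero.comp tendsto_intCast_atTop_atTop
  have hmem : (0 : ℝ) ∈ Prod.fst '' S := by
    refine (isClosedMap_fst_of_compactSpace S hS).mem_of_frequently_of_tendsto
      (h.mono ?_) hlim
    rintro ℓ ⟨w, hw, hwS⟩
    exact ⟨((ℓ : ℝ)⁻¹, ⟨w, hw⟩), hwS, rfl⟩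
  obtain ⟨⟨t, w⟩, hw, rfl⟩ := hmem
  exact ⟨w, w.2, fun ρ => by simpa using hw ρ⟩

/-- Membership of a class in the zonotope, in terms of representatives. -/
theorem picMk_mem_zonotope_of_add {n : ℕ} {ι : Type*} (v : ι → ((Fin n → ℝ) →ₗ[ℝ] ℝ))
    (x : ι → ℝ) (w : Fin n → ℝ) (h : ∀ ρ, -1 ≤ x ρ + v ρ w ∧ x ρ + v ρ w ≤ 0) :
    picMk v x ∈ zonotope v := by
  refine ⟨fun ρ => x ρ + v ρ w, h, (Submodule.Quotient.eq _).mpr ⟨w, ?_⟩⟩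
  ext ρ
  simp

/-- Let `M = ℤⁿ`, `ι` a finite index set, `u : ι → Hom_ℤ(M, ℤ)` extended
`ℝ`-linearly to `v`.  Then for every `D : ι → ℤ` there exists an integer `L` such that for all
`ℓ ≥ L` and all `m ∈ M`, the class in `Pic_ℝ` of the floor divisor `ρ ↦ ⌊(D ρ − u ρ m)/ℓ⌋`
lies in the zonotope `Z`. -/
theorem frob_eventually_in_zonotope
    {n : ℕ} {ι : Type*} [Finite ι]
    (u : ι → ((Fin n → ℤ) →ₗ[ℤ] ℤ))
    (v : ι → ((Fin n → ℝ) →ₗ[ℝ] ℝ))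
    (hv : ∀ (ρ : ι) (m : Fin n → ℤ), v ρ (fun i => (m i : ℝ)) = (u ρ m : ℝ)) :
    ∀ D : ι → ℤ, ∃ L : ℤ, ∀ ℓ : ℤ, L ≤ ℓ → ∀ m : Fin n → ℤ,
      picMk v (fun ρ => (⌊((D ρ - u ρ m : ℤ) : ℝ) / (ℓ : ℝ)⌋ : ℝ)) ∈ zonotope v := by
  intro D
  let K : Set (Fin n → ℝ) := Set.Icc 0 1
  have hK : IsCompact K := isCompact_Icc
  have hbound : ∀ ρ, ∃ B : ℝ, ∀ w ∈ K, ‖v ρ w‖ ≤ B := fun ρ =>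
    hK.exists_bound_of_continuousOn (v ρ).continuous_of_finiteDimensional.continuousOn
  choose B hB using hbound
  let box : Set (ι → ℤ) :=
    Set.univ.pi fun ρ => Set.Icc (-⌈|(D ρ : ℝ)| + 1 + B ρ⌉) ⌈|(D ρ : ℝ)| + 1 + B ρ⌉
  have hbox : box.Finite := Set.Finite.pi fun ρ => Set.finite_Icc _ _
  have hev : ∀ᶠ ℓ : ℤ in Filter.atTop, ∀ F ∈ box,
      (∃ w ∈ K, ∀ ρ, (ℓ : ℝ)⁻¹ * D ρ - 1 ≤ F ρ + v ρ w ∧ F ρ + v ρ w ≤ (ℓ : ℝ)⁻¹ * D ρ) →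
      ∃ w ∈ K, ∀ ρ, -1 ≤ F ρ + v ρ w ∧ F ρ + v ρ w ≤ 0 := by
    refine (Filter.eventually_all_finite hbox).mpr fun F _ => ?_
    by_contra hcon
    have hfr := Filter.not_eventually.mp hcon
    obtain ⟨ℓ, hℓ⟩ := hfr.exists
    exact hℓ fun _ => exists_mem_cube_of_frequently v hK (fun ρ => D ρ) (fun ρ => F ρ)
      (hfr.mono fun ℓ hℓ => (Classical.not_imp.mp hℓ).1)
  obtain ⟨L, hL⟩ := Filter.eventually_atTop.mp (hev.and (Filter.eventually_ge_atTop 1))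
  refine ⟨L, fun ℓ hℓ m => ?_⟩
  obtain ⟨hF, hℓ1⟩ := hL ℓ hℓ
  have hℓ1' : (1 : ℝ) ≤ ℓ := by exact_mod_cast hℓ1
  let q : Fin n → ℤ := fun i => ⌊(m i : ℝ) / ℓ⌋
  let w : Fin n → ℝ := fun i => Int.fract ((m i : ℝ) / ℓ)
  have hw : w ∈ K := ⟨fun i => Int.fract_nonneg _, fun i => (Int.fract_lt_one _).le⟩
  have hvw : ∀ ρ, v ρ w = (ℓ : ℝ)⁻¹ * u ρ m - u ρ q := by
    intro ρ
    rw [← hv, ← hv, ← smul_eq_mul, ← map_smul, ← map_sub]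
    congr 1
    ext i
    simp [w, q, div_eq_inv_mul]
  let F : ι → ℤ := fun ρ => ⌊((D ρ - u ρ m : ℤ) : ℝ) / (ℓ : ℝ)⌋ + u ρ q
  have hFw : ∀ ρ, (ℓ : ℝ)⁻¹ * D ρ - 1 ≤ F ρ + v ρ w ∧
      F ρ + v ρ w ≤ (ℓ : ℝ)⁻¹ * D ρ := by
    intro ρ
    have h1 := Int.floor_le (((D ρ - u ρ m : ℤ) : ℝ) / (ℓ : ℝ))
    have h2 := Int.lt_floor_add_one (((D ρ - u ρ m : ℤ) : ℝ) / (ℓ : ℝ))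
    have h3 : ((D ρ - u ρ m : ℤ) : ℝ) / (ℓ : ℝ) = (ℓ : ℝ)⁻¹ * D ρ - (ℓ : ℝ)⁻¹ * u ρ m := by
      push_cast
      ring
    have h4 : (F ρ : ℝ) = ⌊((D ρ - u ρ m : ℤ) : ℝ) / (ℓ : ℝ)⌋ + u ρ q := by
      simp only [F, Int.cast_add]
    rw [hvw, h4]
    constructor <;> linarith
  have hFbox : F ∈ box := by
    intro ρ _
    have h1 := abs_le.mp (hB ρ w hw)
    have h2 := hFw ρ
    have h3 : |(ℓ : ℝ)⁻¹ * D ρ| ≤ |(D ρ : ℝ)| := by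
      rw [abs_mul, abs_of_nonneg (by positivity)]
      exact mul_le_of_le_one_left (abs_nonneg _) (inv_le_one_of_one_le₀ hℓ1')
    have h4 := abs_le.mp h3
    have h5 := Int.le_ceil (|(D ρ : ℝ)| + 1 + B ρ)
    rw [Set.mem_Icc, ← @Int.cast_le ℝ, ← @Int.cast_le ℝ, Int.cast_neg]
    constructor <;> linarith
  obtain ⟨w', -, hw'⟩ := hF F hFbox ⟨w, hw, hFw⟩
  refine picMk_mem_zonotope_of_add v _ (w' + fun i => (q i : ℝ)) fun ρ => ?_
  have h1 := hw' ρ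
  simp only [F, Int.cast_add] at h1
  rw [map_add, hv]
  constructor <;> linarith
end

section
/- Let k be an algebraically closed field and let L, N, N' be finitely generated free ℤ-modules. Let β : L → N be a ℤ-linear map with finite cokernel, π : N → N' an injective ℤ-linear map with finite cokernel, and β' = π ∘ β. For a finitely generated free ℤ-module P write 𝕋_P := P ⊗_ℤ kˣ, and for a ℤ-linear map f write 𝕋_f := f ⊗ id_{kˣ}. Set G_β := ker(𝕋_β : 𝕋_L → 𝕋_N) and G_{β'} := ker(𝕋_{β'} : 𝕋_L → 𝕋_{N'}). Then 𝕋_β is surjective, G_β ⊆ G_{β'}, and the map 𝕋_β induces a group isomorphism G_{β'}/G_β ≅ ker(𝕋_π : 𝕋_N → 𝕋_{N'}). -/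
open TensorProduct

/- Remove the generic `ℤ`-module instance on additive groups inside this file, so that the
`ℤ`-module structure on tensor products such as `L ⊗[ℤ] Additive kˣ` is found consistently
(this avoids a non-defeq instance diamond; mathematically nothing changes since the
`ℤ`-module structure on an abelian group is unique). -/
attribute [-instance] AddCommGroup.toIntModule

noncomputable instance {k : Type*} [Field k] : Module ℤ (Additive kˣ) :=
  AddCommGroup.toIntModule _

namespace AddMonoidHom

variable {A B C : Type*} [AddCommGroup A] [AddCommGroup B] [AddCommGroup C]

/-- If `f` is surjective, then `f` induces `ker (g ∘ f) / ker f ≃ ker g`. -/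
theorem exists_quotient_ker_comp_equiv (f : A →+ B) (g : B →+ C) (h : A →+ C)
    (hf : Function.Surjective f) (hgf : h = g.comp f) :
    ∃ e : (h.ker ⧸ f.ker.addSubgroupOf h.ker) ≃+ g.ker,
      ∀ x : h.ker, (e (QuotientAddGroup.mk x) : B) = f x := by
  subst hgf
  let φ : (g.comp f).ker →+ g.ker :=
    (f.comp (g.comp f).ker.subtype).codRestrict g.ker fun x => x.2
  have hφ : Function.Surjective φ := by
    rintro ⟨b, hb⟩
    obtain ⟨a, rfl⟩ := hf b
    exact ⟨⟨a, hb⟩, rfl⟩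
  have hker : f.ker.addSubgroupOf (g.comp f).ker = φ.ker := by
    ext x
    rw [AddSubgroup.mem_addSubgroupOf, AddMonoidHom.mem_ker, AddMonoidHom.mem_ker, Subtype.ext_iff]
    rfl
  exact ⟨(QuotientAddGroup.quotientAddEquivOfEq hker).trans
    (QuotientAddGroup.quotientKerEquivOfSurjective φ hφ), fun _ => rfl⟩

end AddMonoidHom

/-- A linear map with finite cokernel becomes surjective after tensoring with a divisible
module. -/
theorem LinearMap.rTensor_surjective_of_finite_coker {M P D : Type*}
    [AddCommGroup M] [Module ℤ M] [AddCommGroup P] [Module ℤ P] [AddCommGroup D] [Module ℤ D]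
    (hD : ∀ n : ℕ, n ≠ 0 → ∀ d : D, ∃ c : D, n • c = d)
    (f : M →ₗ[ℤ] P) (hf : Finite (P ⧸ LinearMap.range f)) :
    Function.Surjective (LinearMap.rTensor D f) := by
  intro t
  induction t using TensorProduct.induction_on with
  | zero => exact ⟨0, map_zero _⟩
  | add x y hx hy =>
    obtain ⟨a, rfl⟩ := hx
    obtain ⟨b, rfl⟩ := hy
    exact ⟨a + b, map_add _ _ _⟩
  | tmul p d =>
    obtain ⟨c, rfl⟩ := hD (Nat.card (P ⧸ LinearMap.range f)) Nat.card_pos.ne' d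
    have hp : Nat.card (P ⧸ LinearMap.range f) • p ∈ LinearMap.range f := by
      rw [← Submodule.Quotient.mk_eq_zero]
      exact card_nsmul_eq_zero' (x := (Submodule.Quotient.mk p : P ⧸ LinearMap.range f))
    obtain ⟨m, hm⟩ := hp
    refine ⟨m ⊗ₜ c, ?_⟩
    rw [LinearMap.rTensor_tmul, hm, TensorProduct.smul_tmul]

/-- The unit group of an algebraically closed field is divisible. -/
theorem IsAlgClosed.exists_nsmul_eq_additive_units {k : Type*} [Field k] [IsAlgClosed k]
    (n : ℕ) (hn : n ≠ 0) (d : Additive kˣ) : ∃ c : Additive kˣ, n • c = d := by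
  obtain ⟨z, hz⟩ := IsAlgClosed.exists_pow_nat_eq (d.toMul : k) (Nat.pos_of_ne_zero hn)
  have hz0 : z ≠ 0 := by
    rintro rfl
    rw [zero_pow hn] at hz
    exact d.toMul.ne_zero hz.symm
  refine ⟨Additive.ofMul (Units.mk0 z hz0), ?_⟩
  apply Additive.toMul.injective
  ext
  simpa using hz

/-- Let `k` be an algebraically closed field and `L, N, N'` finitely
generated free `ℤ`-modules.  Let `β : L → N` be `ℤ`-linear with finite cokernel,
`π : N → N'` injective `ℤ`-linear with finite cokernel, and `β' = π ∘ β`.  Writing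
`𝕋_P := P ⊗_ℤ kˣ` (with `kˣ` viewed additively) and `𝕋_f := f ⊗ id`, and setting
`G_β := ker 𝕋_β`, `G_{β'} := ker 𝕋_{β'}`: then `𝕋_β` is surjective, `G_β ⊆ G_{β'}`, and
`𝕋_β` induces a group isomorphism `G_{β'}/G_β ≅ ker (𝕋_π : 𝕋_N → 𝕋_{N'})`. -/
theorem torus_kernel_quotient_iso
    {k : Type*} [Field k] [IsAlgClosed k]
    {L N N' : Type*}
    [AddCommGroup L] [Module ℤ L] [Module.Free ℤ L] [Module.Finite ℤ L]
    [AddCommGroup N] [Module ℤ N] [Module.Free ℤ N] [Module.Finite ℤ N]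
    [AddCommGroup N'] [Module ℤ N'] [Module.Free ℤ N'] [Module.Finite ℤ N']
    (β : L →ₗ[ℤ] N) (hβcoker : Finite (N ⧸ LinearMap.range β))
    (π : N →ₗ[ℤ] N') (hπinj : Function.Injective π)
    (hπcoker : Finite (N' ⧸ LinearMap.range π))
    (β' : L →ₗ[ℤ] N') (hβ' : β' = π.comp β) :
    Function.Surjective (LinearMap.rTensor (Additive kˣ) β) ∧
    ((LinearMap.rTensor (Additive kˣ) β).toAddMonoidHom.ker
      ≤ (LinearMap.rTensor (Additive kˣ) β').toAddMonoidHom.ker) ∧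
    ∃ e : (↥(LinearMap.rTensor (Additive kˣ) β').toAddMonoidHom.ker ⧸
            ((LinearMap.rTensor (Additive kˣ) β).toAddMonoidHom.ker.addSubgroupOf
              (LinearMap.rTensor (Additive kˣ) β').toAddMonoidHom.ker)) ≃+
          ↥(LinearMap.rTensor (Additive kˣ) π).toAddMonoidHom.ker,
      ∀ x : ↥(LinearMap.rTensor (Additive kˣ) β').toAddMonoidHom.ker,
        (↑(e (QuotientAddGroup.mk x)) : N ⊗[ℤ] Additive kˣ)
          = LinearMap.rTensor (Additive kˣ) β (x : L ⊗[ℤ] Additive kˣ) := by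
  have hsurj : Function.Surjective (LinearMap.rTensor (Additive kˣ) β) :=
    LinearMap.rTensor_surjective_of_finite_coker
      IsAlgClosed.exists_nsmul_eq_additive_units β hβcoker
  have hcomp : LinearMap.rTensor (Additive kˣ) β' =
      (LinearMap.rTensor (Additive kˣ) π).comp (LinearMap.rTensor (Additive kˣ) β) := by
    rw [hβ', LinearMap.rTensor_comp]
  refine ⟨hsurj, fun x hx => ?_, ?_⟩
  · have hx' : LinearMap.rTensor (Additive kˣ) β x = 0 := hx
    change LinearMap.rTensor (Additive kˣ) β' x = 0
    rw [hcomp, LinearMap.comp_apply, hx', map_zero]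
  · exact AddMonoidHom.exists_quotient_ker_comp_equiv
      (LinearMap.rTensor (Additive kˣ) β).toAddMonoidHom
      (LinearMap.rTensor (Additive kˣ) π).toAddMonoidHom
      (LinearMap.rTensor (Additive kˣ) β').toAddMonoidHom hsurj
      (congrArg LinearMap.toAddMonoidHom hcomp)
end
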